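/- For t > 0, the Katugampola fractional derivative limit lim_{h→0} (f(t·e^{h·t^{-α}}) - f(t))/h exists if and only if f'(t) exists, and in that case it equals t^{1-α}·f'(t). -/

import Mathlib

open Filter Set Topology Real

/-- Katugampola derivative: for t > 0 the limit
`lim_{h→0} (f(t·exp(h·t^{-α})) - f(t))/h` exists iff `f` is differentiable at `t`,
and in that case it equals `t^{1-α}·f'(t)`. -/
theorem katugampola_iff_deriv (α : ℝ) (hα0 : 0 < α) (hα1 : α < 1)
    (f : ℝ → ℝ) (t : ℝ) (ht : 0 < t) :
    ((∃ L : ℝ, Tendsto (fun h : ℝ => (f (t * Real.exp (h * t ^ (-α))) - f t) / h)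
        (𝓝[≠] (0:ℝ)) (𝓝 L)) ↔ DifferentiableAt ℝ f t) ∧
    (DifferentiableAt ℝ f t →
      Tendsto (fun h : ℝ => (f (t * Real.exp (h * t ^ (-α))) - f t) / h)
        (𝓝[≠] (0:ℝ)) (𝓝 (t ^ (1 - α) * deriv f t))) := by
  have hc : 0 < t ^ (-α) := Real.rpow_pos_of_pos ht _
  have hct : t * t ^ (-α) = t ^ (1 - α) := by
    rw [sub_eq_add_neg, Real.rpow_add ht, Real.rpow_one]
  generalize t ^ (-α) = c at *
  have key : ∀ L : ℝ, Tendsto (fun h : ℝ => (f (t * Real.exp (h * c)) - f t) / h)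
      (𝓝[≠] (0:ℝ)) (𝓝 L) ↔ HasDerivAt (fun h : ℝ => f (t * Real.exp (h * c))) L 0 := by
    intro L
    rw [hasDerivAt_iff_tendsto_slope]
    apply iff_of_eq
    congr 1
    funext h
    simp [slope_def_field]
  have fwd : DifferentiableAt ℝ f t →
      Tendsto (fun h : ℝ => (f (t * Real.exp (h * c)) - f t) / h)
        (𝓝[≠] (0:ℝ)) (𝓝 (t ^ (1 - α) * deriv f t)) := by
    intro hf
    rw [key]
    have h1 : HasDerivAt (fun h : ℝ => t * Real.exp (h * c)) (t * c) 0 := by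
      have := (((hasDerivAt_id (0:ℝ)).mul_const c).exp).const_mul t
      simpa using this
    have h2 : HasDerivAt f (deriv f t) (t * Real.exp (0 * c)) := by
      simpa using hf.hasDerivAt
    have h3 := HasDerivAt.comp (0:ℝ) h2 h1
    rw [← hct, mul_comm]
    exact h3
  refine ⟨⟨?_, fun hf => ⟨_, fwd hf⟩⟩, fwd⟩
  rintro ⟨L, hL⟩
  rw [key] at hL
  have hd : DifferentiableAt ℝ (fun x : ℝ => Real.log (x / t) / c) t := by
    have : t / t ≠ 0 := by positivity
    exact ((differentiableAt_id.div_const t).log this).div_const c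
  have h0 : Real.log (t / t) / c = 0 := by rw [div_self ht.ne']; simp
  have hg : DifferentiableAt ℝ (fun h : ℝ => f (t * Real.exp (h * c)))
      ((fun x : ℝ => Real.log (x / t) / c) t) := by
    simp only [h0]
    exact hL.differentiableAt
  refine (DifferentiableAt.comp t hg hd).congr_of_eventuallyEq ?_
  filter_upwards [lt_mem_nhds ht] with x hx
  simp only [Function.comp]
  rw [div_mul_cancel₀ _ hc.ne', Real.exp_log (by positivity), mul_div_cancel₀ _ ht.ne']
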